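/- Let N ≥ 1, f : ℝ^N → ℝ differentiable with L_f-Lipschitz gradient (L_f > 0), g : ℝ → ℝ convex, and h : ℝ → ℝ concave and differentiable with h'(t) > 0 for every t in the range of g. Let 0 < μ < 2/L_f, x, e ∈ ℝ^N, set w_i := h'(g(x_i)) for i = 1,…,N, and let x⁺ ∈ ℝ^N be such that for each i there exists v_i ∈ ℝ with g(s) ≥ g(x⁺_i) + v_i(s − x⁺_i) for all s ∈ ℝ (v_i is a subgradient of g at x⁺_i) and ∇_i f(x) + w_i v_i + (x⁺_i − x_i)/μ − e_i/μ = 0. Then, with Ψ(u) := f(u) + ∑_{i=1}^N h(g(u_i)), Ψ(x) − Ψ(x⁺) ≥ (1/2)(1/μ − L_f/2)‖x − x⁺‖² − ‖e‖²/(μ(2 − μL_f)). -/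

import Mathlib

open Filter Topology

lemma descent_aux {N : ℕ}
    (f : EuclideanSpace ℝ (Fin N) → ℝ)
    (f' : EuclideanSpace ℝ (Fin N) → EuclideanSpace ℝ (Fin N)) (Lf : ℝ)
    (hdiff : ∀ u, HasFDerivAt f (innerSL ℝ (f' u)) u)
    (hlip : ∀ u v, ‖f' u - f' v‖ ≤ Lf * ‖u - v‖)
    (x p : EuclideanSpace ℝ (Fin N)) :
    f (x + p) ≤ f x + inner ℝ (f' x) p + Lf / 2 * ‖p‖ ^ 2 := by
  have hd : ∀ t : ℝ, HasDerivAt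
      (fun t : ℝ => f (x + t • p) - t * inner ℝ (f' x) p - t ^ 2 * (Lf / 2 * ‖p‖ ^ 2))
      (inner ℝ (f' (x + t • p)) p - inner ℝ (f' x) p - 2 * t * (Lf / 2 * ‖p‖ ^ 2)) t := by
    intro t
    have h1 : HasDerivAt (fun t : ℝ => x + t • p) p t := by
      simpa using ((hasDerivAt_id t).smul_const p).const_add x
    have h2 := (hdiff (x + t • p)).comp_hasDerivAt t h1
    have h3 := (hasDerivAt_id t).mul_const (inner ℝ (f' x) p)
    have h4 := (hasDerivAt_pow 2 t).mul_const (Lf / 2 * ‖p‖ ^ 2)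
    have h5 := (h2.sub h3).sub h4
    refine HasDerivAt.congr_deriv h5 ?_
    simp
  have hanti := antitoneOn_of_deriv_nonpos (convex_Icc (0:ℝ) 1)
    (fun t _ => (hd t).continuousAt.continuousWithinAt)
    (fun t _ => (hd t).differentiableAt.differentiableWithinAt)
    (by
      intro t ht
      rw [interior_Icc] at ht
      rw [(hd t).deriv, ← inner_sub_left]
      have h1 := real_inner_le_norm (f' (x + t • p) - f' x) p
      have h2 := hlip (x + t • p) x
      rw [add_sub_cancel_left, norm_smul, Real.norm_of_nonneg ht.1.le] at h2
      nlinarith [mul_le_mul_of_nonneg_right h2 (norm_nonneg p)])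
  have := hanti (Set.left_mem_Icc.2 zero_le_one) (Set.right_mem_Icc.2 zero_le_one) zero_le_one
  simp at this
  linarith

lemma concave_tangent (h : ℝ → ℝ) (d a b : ℝ) (hc : ConcaveOn ℝ Set.univ h)
    (hd : HasDerivAt h d a) : h b ≤ h a + d * (b - a) := by
  rcases lt_trichotomy a b with hab | rfl | hab
  · have := hc.slope_le_of_hasDerivAt (Set.mem_univ a) (Set.mem_univ b) hab hd
    rw [slope_def_field, div_le_iff₀ (by linarith)] at this
    linarith
  · simp
  · have := hc.le_slope_of_hasDerivAt (Set.mem_univ b) (Set.mem_univ a) hab hd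
    rw [slope_def_field, le_div_iff₀ (by linarith)] at this
    linarith

/-- Pseudo sufficient descent for one step of the inexact proximal iteratively
    reweighted (PIRE) algorithm for Ψ(u) = f(u) + ∑ᵢ h(g(uᵢ)). -/
theorem inexact_pire_descent (N : ℕ) (hN : 1 ≤ N)
    (f : EuclideanSpace ℝ (Fin N) → ℝ)
    (f' : EuclideanSpace ℝ (Fin N) → EuclideanSpace ℝ (Fin N))
    (g : ℝ → ℝ) (h : ℝ → ℝ) (h' : ℝ → ℝ) (Lf μ : ℝ) (hLf : 0 < Lf)
    (hdiff : ∀ u, HasFDerivAt f (innerSL ℝ (f' u)) u)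
    (hlip : ∀ u v, ‖f' u - f' v‖ ≤ Lf * ‖u - v‖)
    (hgconv : ConvexOn ℝ Set.univ g)
    (hhconc : ConcaveOn ℝ Set.univ h)
    (hhd : ∀ t : ℝ, HasDerivAt h (h' t) t)
    (hpos : ∀ t ∈ Set.range g, 0 < h' t)
    (hμ : 0 < μ) (hμL : μ < 2 / Lf)
    (x xp e : EuclideanSpace ℝ (Fin N)) (v : Fin N → ℝ)
    (hsub : ∀ i, ∀ s : ℝ, g s ≥ g (xp i) + v i * (s - xp i))
    (hstat : ∀ i, f' x i + h' (g (x i)) * v i + (xp i - x i) / μ - e i / μ = 0) :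
    (f x + ∑ i, h (g (x i))) - (f xp + ∑ i, h (g (xp i))) ≥
      (1 / 2) * (1 / μ - Lf / 2) * ‖x - xp‖ ^ 2 - ‖e‖ ^ 2 / (μ * (2 - μ * Lf)) := by
  have h1 := descent_aux f f' Lf hdiff hlip x (xp - x)
  rw [add_sub_cancel, norm_sub_rev] at h1
  have h2 : ∀ i, (-(f' x i) * (x i - xp i) + ((x i - xp i) * (x i - xp i)
      + e i * (x i - xp i)) / μ) ≤ h (g (x i)) - h (g (xp i)) := by
    intro i
    have a1 := concave_tangent h _ (g (x i)) (g (xp i)) hhconc (hhd _)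
    have a2 := mul_le_mul_of_nonneg_left (hsub i (x i)) (hpos (g (x i)) ⟨_, rfl⟩).le
    have a3 : h' (g (x i)) * v i = -(f' x i) + ((x i - xp i) + e i) / μ := by
      have := hstat i
      field_simp at this ⊢
      linarith
    have a4 : h' (g (x i)) * v i * (x i - xp i) = -(f' x i) * (x i - xp i)
        + ((x i - xp i) * (x i - xp i) + e i * (x i - xp i)) / μ := by
      rw [a3]; ring
    linarith
  have h3 := Finset.sum_le_sum (fun i (_ : i ∈ Finset.univ) => h2 i)
  have h4 : ∑ i, (-(f' x i) * (x i - xp i) + ((x i - xp i) * (x i - xp i)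
      + e i * (x i - xp i)) / μ)
      = inner ℝ (f' x) (xp - x) + (‖x - xp‖ ^ 2 + inner ℝ e (x - xp)) / μ := by
    rw [← real_inner_self_eq_norm_sq]
    simp only [PiLp.inner_apply, Finset.sum_add_distrib, ← Finset.sum_div]
    congr 1
    · refine Finset.sum_congr rfl fun i _ => ?_
      simp
      ring
    · congr 2
      refine Finset.sum_congr rfl fun i _ => ?_
      simp
      ring
  rw [h4, Finset.sum_sub_distrib] at h3
  have hc : 0 < 2 - μ * Lf := by
    rw [lt_div_iff₀ hLf] at hμL
    linarith
  have h5 : -(‖e‖ * ‖x - xp‖) ≤ inner ℝ e (x - xp) :=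
    (abs_le.1 (abs_real_inner_le_norm e (x - xp))).1
  have h6 : 0 ≤ (1 / 2) * (1 / μ - Lf / 2) * ‖x - xp‖ ^ 2
      - (‖e‖ * ‖x - xp‖) / μ + ‖e‖ ^ 2 / (μ * (2 - μ * Lf)) := by
    have : (1 / 2) * (1 / μ - Lf / 2) * ‖x - xp‖ ^ 2
      - (‖e‖ * ‖x - xp‖) / μ + ‖e‖ ^ 2 / (μ * (2 - μ * Lf))
      = ((2 - μ * Lf) * ‖x - xp‖ - 2 * ‖e‖) ^ 2 / (4 * μ * (2 - μ * Lf)) := by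
      have := hc.ne'
      field_simp
      ring
    rw [this]
    positivity
  have h7 := div_le_div_of_nonneg_right h5 hμ.le
  rw [neg_div] at h7
  rw [add_div] at h3
  have h8 : (1 / μ - Lf / 2) * ‖x - xp‖ ^ 2 = ‖x - xp‖ ^ 2 / μ - Lf / 2 * ‖x - xp‖ ^ 2 := by ring
  linarith
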